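/- For s ∈ (0,1) and σ ∈ (−1,1), let θ(s,σ) ∈ (0,π) be the unique angle such that, with H = {x ∈ ℝ² : x₂ > 0}, J_θ = {x ∈ ℝ² : x₂ > 0 and (cos α) x₂ = (sin α) x₁ for some α ∈ (0,θ)}, and e(θ) = (cos θ, sin θ), one has lim_{ρ→0⁺} ∫_{{z : |z−e(θ)|>ρ}} (1_{H∖J_θ}(z) + σ 1_{ℝ²∖H}(z) − 1_{J_θ}(z)) |e(θ)−z|^{−(2+s)} dz = 0. Then for every σ ∈ (−1,1), lim_{s→1⁻} cos(π − θ(s,σ)) = σ. -/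

import Mathlib

open MeasureTheory Filter Metric
open scoped ENNReal NNReal Topology

/-- The upper half space `H = {x ∈ ℝⁿ : x_n > 0}`. -/
def Hset (n : ℕ) (hn : 2 ≤ n) : Set (EuclideanSpace ℝ (Fin n)) :=
  {x | 0 < x ⟨n - 1, by omega⟩}

/-- The cone `J_θ = {x : x_n > 0 and cos α · x_n = sin α · x_1 for some α ∈ (0,θ)}`. -/
def Jset (n : ℕ) (hn : 2 ≤ n) (θ : ℝ) : Set (EuclideanSpace ℝ (Fin n)) :=
  {x | 0 < x ⟨n - 1, by omega⟩ ∧ ∃ α ∈ Set.Ioo 0 θ,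
    Real.cos α * x ⟨n - 1, by omega⟩ = Real.sin α * x ⟨0, by omega⟩}

/-- The point `e(θ) = cos θ e₁ + sin θ e_n`. -/
noncomputable def ePt (n : ℕ) (hn : 2 ≤ n) (θ : ℝ) : EuclideanSpace ℝ (Fin n) :=
  Real.cos θ • EuclideanSpace.single ⟨0, by omega⟩ (1 : ℝ)
    + Real.sin θ • EuclideanSpace.single ⟨n - 1, by omega⟩ (1 : ℝ)

/-- The nonlocal Young's law equation for the angle `θ`: the principal value of
`∫ (1_{H∖J_θ} + σ 1_{Hᶜ} − 1_{J_θ})(z) |e(θ)−z|^{-(n+s)} dz` vanishes. -/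
def YoungPV (n : ℕ) (hn : 2 ≤ n) (s σ θ : ℝ) : Prop :=
  Tendsto (fun ρ : ℝ => ∫ z in {z | ρ < dist z (ePt n hn θ)},
      (Set.indicator (Hset n hn \ Jset n hn θ) (fun _ => (1 : ℝ)) z
        + σ * Set.indicator (Hset n hn)ᶜ (fun _ => (1 : ℝ)) z
        - Set.indicator (Jset n hn θ) (fun _ => (1 : ℝ)) z)
      * ‖ePt n hn θ - z‖ ^ (-((n : ℝ) + s)))
    (𝓝[>] (0 : ℝ)) (nhds 0)

open Set in
/-- Polar coordinates around an arbitrary centre in the Euclidean plane. -/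
theorem integral_euclideanPlane_eq_polar (f : EuclideanSpace ℝ (Fin 2) → ℝ)
    (c : EuclideanSpace ℝ (Fin 2)) :
    ∫ z, f z = ∫ p in Ioi (0 : ℝ) ×ˢ Ioo (-Real.pi) Real.pi,
      p.1 * f (c + !₂[p.1 * Real.cos p.2, p.1 * Real.sin p.2]) := by
  rw [← integral_add_left_eq_self f c, ← ((EuclideanSpace.volume_preserving_symm_measurableEquiv_toLp
      (Fin 2)).symm).integral_comp' (fun z => f (c + z)),
    ← ((volume_preserving_finTwoArrow ℝ).symm).integral_comp', ← integral_comp_polarCoord_symm]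
  rfl

open Set in
/-- Radial integral along a ray which leaves a half plane at height `h` with slope `c`. -/
theorem integral_Ioi_rpow_mul_ite {s ρ h c ε σ : ℝ} (hs : 0 < s) (hρ : 0 < ρ) (hh : ρ < h)
    (hc : -1 ≤ c) :
    ∫ r in Ioi ρ, r ^ (-(1 + s)) * (if 0 < h + r * c then ε else σ)
      = (ε * ρ ^ (-s) + (σ - ε) * (max (-c) 0 / h) ^ s) / s := by
  have hint : ∀ R : ℝ, 0 < R → ∫ r in Ioi R, r ^ (-(1 + s)) = R ^ (-s) / s := by
    intro R hR
    rw [integral_Ioi_rpow_of_lt (by linarith) hR, show -(1 + s) + 1 = -s by ring, neg_div_neg_eq]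
  have hh0 : 0 < h := hρ.trans hh
  rcases le_or_gt 0 c with hc0 | hc0
  · have : ∫ r in Ioi ρ, r ^ (-(1 + s)) * (if 0 < h + r * c then ε else σ)
        = ∫ r in Ioi ρ, r ^ (-(1 + s)) * ε := by
      refine setIntegral_congr_fun measurableSet_Ioi fun r hr => ?_
      have : 0 ≤ r * c := mul_nonneg (hρ.trans hr).le hc0
      simp only [if_pos (show 0 < h + r * c by linarith)]
    rw [this, integral_mul_const, hint ρ hρ, max_eq_right (by linarith), zero_div,
      Real.zero_rpow hs.ne']
    ring
  · set R := h / (-c) with hR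
    have hc' : 0 < -c := by linarith
    have hR0 : 0 < R := div_pos hh0 hc'
    have hρR : ρ < R := by
      rw [hR, lt_div_iff₀ hc']
      nlinarith
    have hio : IntegrableOn (fun r : ℝ => r ^ (-(1 + s))) (Ioi ρ) :=
      integrableOn_Ioi_rpow_of_lt (by linarith) hρ
    have : ∫ r in Ioi ρ, r ^ (-(1 + s)) * (if 0 < h + r * c then ε else σ)
        = ∫ r in Ioi ρ, (r ^ (-(1 + s)) * ε
            + (Ici R).indicator (fun r => r ^ (-(1 + s)) * (σ - ε)) r) := by
      refine setIntegral_congr_fun measurableSet_Ioi fun r hr => ?_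
      have hiff : r ∈ Ici R ↔ ¬ 0 < h + r * c := by
        rw [mem_Ici, hR, div_le_iff₀ hc', not_lt]
        constructor <;> intro h <;> linarith
      by_cases hr' : 0 < h + r * c
      · simp [if_pos hr', indicator_of_notMem (fun h => hiff.1 h hr')]
      · simp only [if_neg hr', indicator_of_mem (hiff.2 hr')]
        ring
    rw [this, integral_add (hio.mul_const _)
      ((hio.mul_const _).indicator measurableSet_Ici), setIntegral_indicator measurableSet_Ici,
      inter_eq_self_of_subset_right (Ici_subset_Ioi.2 hρR), integral_Ici_eq_integral_Ioi,
      integral_mul_const, integral_mul_const, hint ρ hρ, hint R hR0, max_eq_left hc'.le, hR,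
      Real.rpow_neg (div_pos hh0 hc').le, ← Real.inv_rpow (div_pos hh0 hc').le, inv_div]
    ring

/-- The side of the line through the origin at angle `θ` towards which the direction `φ` points. -/
noncomputable def sideSign (θ φ : ℝ) : ℝ := if 0 ≤ Real.sin (φ - θ) then 1 else -1

theorem measurable_sideSign (θ : ℝ) : Measurable (sideSign θ) :=
  Measurable.ite (measurableSet_le (by fun_prop) (by fun_prop)) (by fun_prop) (by fun_prop)

theorem abs_sideSign_le (θ φ : ℝ) : |sideSign θ φ| ≤ 1 := by
  unfold sideSign
  split_ifs <;> simp

/-- Points of the cone `Jset` in the plane, described by linear inequalities. -/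
theorem mem_Jset_two_iff {θ : ℝ} (hθ : θ ∈ Set.Ioo 0 Real.pi) (x : EuclideanSpace ℝ (Fin 2)) :
    x ∈ Jset 2 le_rfl θ ↔ 0 < x 1 ∧ 0 < Real.sin θ * x 0 - Real.cos θ * x 1 := by
  change (0 < x 1 ∧ ∃ α ∈ Set.Ioo 0 θ, Real.cos α * x 1 = Real.sin α * x 0) ↔ _
  refine and_congr_right fun hx => ?_
  have key : ∀ α, Real.cos α * x 1 = Real.sin α * x 0 →
      Real.sin α * (Real.sin θ * x 0 - Real.cos θ * x 1) = Real.sin (θ - α) * x 1 := by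
    intro α h
    rw [Real.sin_sub]
    linear_combination -Real.sin θ * h
  constructor
  · rintro ⟨α, ⟨h0, h1⟩, h⟩
    have hsin : 0 < Real.sin α := Real.sin_pos_of_pos_of_lt_pi h0 (h1.trans hθ.2)
    have hsub : 0 < Real.sin (θ - α) :=
      Real.sin_pos_of_pos_of_lt_pi (by linarith) (by linarith [hθ.2])
    exact pos_of_mul_pos_right ((key α h).symm ▸ mul_pos hsub hx) hsin.le
  · intro h
    set a := Real.arctan (x 0 / x 1)
    have ha := Real.arctan_lt_pi_div_two (x 0 / x 1)
    have ha' := Real.neg_pi_div_two_lt_arctan (x 0 / x 1)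
    have heq : Real.cos (Real.pi / 2 - a) * x 1 = Real.sin (Real.pi / 2 - a) * x 0 := by
      rw [Real.cos_pi_div_two_sub, Real.sin_pi_div_two_sub]
      have h1 : Real.tan a = x 0 / x 1 := Real.tan_arctan _
      rw [Real.tan_eq_sin_div_cos, div_eq_div_iff (Real.cos_arctan_pos _).ne' hx.ne'] at h1
      rw [h1, mul_comm]
    refine ⟨Real.pi / 2 - a, ⟨by linarith, ?_⟩, heq⟩
    by_contra! hle
    have hsin : 0 < Real.sin (Real.pi / 2 - a) :=
      Real.sin_pos_of_pos_of_lt_pi (by linarith) (by linarith)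
    have hsub : Real.sin (θ - (Real.pi / 2 - a)) ≤ 0 :=
      Real.sin_nonpos_of_nonpos_of_neg_pi_le (by linarith) (by linarith [hθ.1])
    have := key _ heq
    nlinarith [mul_pos hsin h]

theorem ePt_two_apply_zero (θ : ℝ) : ePt 2 le_rfl θ 0 = Real.cos θ := by
  simp [ePt]

theorem ePt_two_apply_one (θ : ℝ) : ePt 2 le_rfl θ 1 = Real.sin θ := by
  simp [ePt]

theorem norm_polar {r φ : ℝ} (hr : 0 ≤ r) :
    ‖(!₂[r * Real.cos φ, r * Real.sin φ] : EuclideanSpace ℝ (Fin 2))‖ = r := by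
  rw [EuclideanSpace.norm_eq, Fin.sum_univ_two]
  have : ‖r * Real.cos φ‖ ^ 2 + ‖r * Real.sin φ‖ ^ 2 = r ^ 2 := by
    simp only [Real.norm_eq_abs, sq_abs]
    linear_combination r ^ 2 * Real.sin_sq_add_cos_sq φ
  change √(‖r * Real.cos φ‖ ^ 2 + ‖r * Real.sin φ‖ ^ 2) = r
  rw [this, Real.sqrt_sq hr]

/-- The weight in `YoungPV`, in polar coordinates around `ePt`. -/
theorem youngWeight_polar {θ r σ : ℝ} (hθ : θ ∈ Set.Ioo 0 Real.pi) (φ : ℝ) (hr : 0 < r) :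
    (Set.indicator (Hset 2 le_rfl \ Jset 2 le_rfl θ) (fun _ => (1 : ℝ))
        (ePt 2 le_rfl θ + !₂[r * Real.cos φ, r * Real.sin φ])
      + σ * Set.indicator (Hset 2 le_rfl)ᶜ (fun _ => (1 : ℝ))
        (ePt 2 le_rfl θ + !₂[r * Real.cos φ, r * Real.sin φ])
      - Set.indicator (Jset 2 le_rfl θ) (fun _ => (1 : ℝ))
        (ePt 2 le_rfl θ + !₂[r * Real.cos φ, r * Real.sin φ]))
      = if 0 < Real.sin θ + r * Real.sin φ then sideSign θ φ else σ := by
  classical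
  set x := ePt 2 le_rfl θ + !₂[r * Real.cos φ, r * Real.sin φ] with hx
  have h0 : x 0 = Real.cos θ + r * Real.cos φ := by
    simp [hx, ePt_two_apply_zero]
  have h1 : x 1 = Real.sin θ + r * Real.sin φ := by
    simp [hx, ePt_two_apply_one]
  have hH : x ∈ Hset 2 le_rfl ↔ 0 < Real.sin θ + r * Real.sin φ := by
    rw [← h1]; rfl
  have hJ : x ∈ Jset 2 le_rfl θ ↔
      0 < Real.sin θ + r * Real.sin φ ∧ Real.sin (φ - θ) < 0 := by
    rw [mem_Jset_two_iff hθ, h0, h1]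
    refine and_congr_right fun _ => ?_
    rw [show Real.sin θ * (Real.cos θ + r * Real.cos φ) - Real.cos θ * (Real.sin θ + r * Real.sin φ)
      = r * (-Real.sin (φ - θ)) by rw [Real.sin_sub]; ring, mul_pos_iff_of_pos_left hr, neg_pos]
  simp only [Set.indicator_apply, Set.mem_sdiff, Set.mem_compl_iff, hH, hJ, sideSign]
  by_cases hp : 0 < Real.sin θ + r * Real.sin φ <;> by_cases hq : 0 ≤ Real.sin (φ - θ) <;>
    simp [hp, hq, not_lt.2, not_le.1]

open Set in
theorem integrable_youngPolar {s σ θ ρ : ℝ} (hs : 0 < s) (hρ : 0 < ρ) :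
    Integrable (fun p : ℝ × ℝ => p.1 ^ (-(1 + s))
        * (if 0 < Real.sin θ + p.1 * Real.sin p.2 then sideSign θ p.2 else σ))
      ((volume.restrict (Ioi ρ)).prod (volume.restrict (Ioo (-Real.pi) Real.pi))) := by
  have hio : Integrable (fun r : ℝ => r ^ (-(1 + s))) (volume.restrict (Ioi ρ)) :=
    integrableOn_Ioi_rpow_of_lt (by linarith) hρ
  have hone : Integrable (fun p : ℝ × ℝ => p.1 ^ (-(1 + s)))
      ((volume.restrict (Ioi ρ)).prod (volume.restrict (Ioo (-Real.pi) Real.pi))) := by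
    simpa using hio.mul_prod (integrable_const (1 : ℝ))
  refine hone.mul_bdd (c := max 1 |σ|) ?_ (ae_of_all _ fun p => ?_)
  · refine (Measurable.ite (measurableSet_lt (by fun_prop) (by fun_prop))
      ((measurable_sideSign θ).comp measurable_snd) measurable_const).aestronglyMeasurable
  · rw [Real.norm_eq_abs]
    split_ifs
    · exact (abs_sideSign_le _ _).trans (le_max_left _ _)
    · exact le_max_right _ _

open Set in
/-- The truncated integral in `YoungPV` as an angular integral. -/
theorem youngIntegral_eq_angular {s σ θ ρ : ℝ} (hs : 0 < s) (hθ : θ ∈ Set.Ioo 0 Real.pi)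
    (hρ : 0 < ρ) (hρθ : ρ < Real.sin θ) :
    (∫ z in {z | ρ < dist z (ePt 2 le_rfl θ)},
      (Set.indicator (Hset 2 le_rfl \ Jset 2 le_rfl θ) (fun _ => (1 : ℝ)) z
        + σ * Set.indicator (Hset 2 le_rfl)ᶜ (fun _ => (1 : ℝ)) z
        - Set.indicator (Jset 2 le_rfl θ) (fun _ => (1 : ℝ)) z)
      * ‖ePt 2 le_rfl θ - z‖ ^ (-(((2 : ℕ) : ℝ) + s)))
    = ∫ φ in Ioo (-Real.pi) Real.pi, (sideSign θ φ * ρ ^ (-s)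
        + (σ - sideSign θ φ) * (max (-Real.sin φ) 0 / Real.sin θ) ^ s) / s := by
  rw [← integral_indicator (measurableSet_lt measurable_const (by fun_prop)),
    integral_euclideanPlane_eq_polar _ (ePt 2 le_rfl θ)]
  have hcongr : ∀ p ∈ Ioi (0 : ℝ) ×ˢ Ioo (-Real.pi) Real.pi,
      p.1 * indicator {z | ρ < dist z (ePt 2 le_rfl θ)} (fun z =>
        (Set.indicator (Hset 2 le_rfl \ Jset 2 le_rfl θ) (fun _ => (1 : ℝ)) z
          + σ * Set.indicator (Hset 2 le_rfl)ᶜ (fun _ => (1 : ℝ)) z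
          - Set.indicator (Jset 2 le_rfl θ) (fun _ => (1 : ℝ)) z)
        * ‖ePt 2 le_rfl θ - z‖ ^ (-(((2 : ℕ) : ℝ) + s)))
        (ePt 2 le_rfl θ + !₂[p.1 * Real.cos p.2, p.1 * Real.sin p.2])
      = indicator (Ioi ρ ×ˢ univ) (fun p : ℝ × ℝ => p.1 ^ (-(1 + s))
        * (if 0 < Real.sin θ + p.1 * Real.sin p.2 then sideSign θ p.2 else σ)) p := by
    rintro ⟨r, φ⟩ ⟨hr : 0 < r, -⟩
    simp only [indicator_apply (s := {z | ρ < dist z (ePt 2 le_rfl θ)}), mem_ofPred_eq,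
      dist_self_add_left, norm_polar hr.le, youngWeight_polar hθ φ hr, sub_add_cancel_left,
      norm_neg, indicator_apply (s := Ioi ρ ×ˢ (univ : Set ℝ)), mem_prod, mem_Ioi, mem_univ,
      and_true, mul_ite, mul_zero]
    split_ifs with h1
    all_goals try rfl
    all_goals
      rw [show -(1 + s) = 1 + -(((2 : ℕ) : ℝ) + s) by push_cast; ring, Real.rpow_add hr,
        Real.rpow_one]
      ring
  rw [setIntegral_congr_fun (measurableSet_Ioi.prod measurableSet_Ioo) hcongr,
    setIntegral_indicator (measurableSet_Ioi.prod MeasurableSet.univ), prod_inter_prod, inter_univ,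
    inter_eq_self_of_subset_right (Ioi_subset_Ioi hρ.le), Measure.volume_eq_prod,
    ← Measure.prod_restrict, integral_prod_symm _ (integrable_youngPolar hs hρ)]
  refine integral_congr_ae (ae_of_all _ fun φ => ?_)
  exact integral_Ioi_rpow_mul_ite (ε := sideSign θ φ) (σ := σ) hs hρ hρθ (Real.neg_one_le_sin φ)

theorem continuous_sin_rpow {s : ℝ} (hs : 0 < s) : Continuous fun t : ℝ => Real.sin t ^ s :=
  Real.continuous_sin.rpow_const fun _ => Or.inr hs.le

/-- Evaluation of the angular integral. -/
theorem angularIntegral_eq {s σ θ ρ : ℝ} (hs : 0 < s) (hθ : θ ∈ Set.Ioo 0 Real.pi) :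
    (∫ φ in Set.Ioo (-Real.pi) Real.pi, (sideSign θ φ * ρ ^ (-s)
        + (σ - sideSign θ φ) * (max (-Real.sin φ) 0 / Real.sin θ) ^ s) / s)
    = (Real.sin θ ^ s)⁻¹ / s * (σ * (∫ t in (0 : ℝ)..Real.pi, Real.sin t ^ s)
        + (∫ t in θ..Real.pi, Real.sin t ^ s) - ∫ t in (0 : ℝ)..θ, Real.sin t ^ s) := by
  obtain ⟨h0, h1⟩ := hθ
  have hsinθ : 0 < Real.sin θ := Real.sin_pos_of_pos_of_lt_pi h0 h1
  set A := ρ ^ (-s)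
  set B := (Real.sin θ ^ s)⁻¹ with hB
  have hcont := continuous_sin_rpow hs
  have hcont' : Continuous fun φ : ℝ => Real.sin (φ + Real.pi) ^ s :=
    hcont.comp (continuous_add_const _)
  have hii : ∀ a b, IntervalIntegrable (fun t : ℝ => Real.sin t ^ s) volume a b :=
    fun a b => hcont.intervalIntegrable a b
  rw [← integral_Ioc_eq_integral_Ioo, ← intervalIntegral.integral_of_le (by linarith)]
  set F : ℝ → ℝ := fun φ => (sideSign θ φ * A
        + (σ - sideSign θ φ) * (max (-Real.sin φ) 0 / Real.sin θ) ^ s) / s with hF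
  have upper : ∀ φ ∈ Set.Icc 0 Real.pi, F φ = sideSign θ φ * A / s := by
    intro φ hφ
    have := Real.sin_nonneg_of_nonneg_of_le_pi hφ.1 hφ.2
    simp only [hF]
    rw [max_eq_right (by linarith), zero_div, Real.zero_rpow hs.ne', mul_zero, add_zero]
  have lower : ∀ φ ∈ Set.Icc (-Real.pi) 0, F φ = sideSign θ φ * A / s
      + (σ - sideSign θ φ) * B / s * Real.sin (φ + Real.pi) ^ s := by
    intro φ hφ
    have := Real.sin_nonpos_of_nonpos_of_neg_pi_le hφ.2 hφ.1
    simp only [hF]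
    rw [max_eq_left (by linarith), Real.sin_add_pi, Real.div_rpow (by linarith) hsinθ.le, hB]
    ring
  have e1 : Set.EqOn F (fun φ => A / s + (σ - 1) * B / s * Real.sin (φ + Real.pi) ^ s)
      (Set.uIoo (-Real.pi) (θ - Real.pi)) := by
    rw [Set.uIoo_of_le (by linarith)]
    intro φ hφ
    have hε : sideSign θ φ = 1 := if_pos <| by
      rw [← Real.sin_add_two_pi]
      exact Real.sin_nonneg_of_nonneg_of_le_pi (by linarith [hφ.1]) (by linarith [hφ.2])
    rw [lower φ ⟨hφ.1.le, by linarith [hφ.2]⟩, hε, one_mul]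
  have e2 : Set.EqOn F (fun φ => -A / s + (σ + 1) * B / s * Real.sin (φ + Real.pi) ^ s)
      (Set.uIoo (θ - Real.pi) 0) := by
    rw [Set.uIoo_of_le (by linarith)]
    intro φ hφ
    have hε : sideSign θ φ = -1 := if_neg <| not_le.2 <|
      Real.sin_neg_of_neg_of_neg_pi_lt (by linarith [hφ.2]) (by linarith [hφ.1])
    rw [lower φ ⟨by linarith [hφ.1], hφ.2.le⟩, hε]
    ring
  have e3 : Set.EqOn F (fun _ => -A / s) (Set.uIoo 0 θ) := by
    rw [Set.uIoo_of_le h0.le]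
    intro φ hφ
    have hε : sideSign θ φ = -1 := if_neg <| not_le.2 <|
      Real.sin_neg_of_neg_of_neg_pi_lt (by linarith [hφ.2]) (by linarith [hφ.1])
    rw [upper φ ⟨hφ.1.le, by linarith [hφ.2]⟩, hε]
    ring
  have e4 : Set.EqOn F (fun _ => A / s) (Set.uIoo θ Real.pi) := by
    rw [Set.uIoo_of_le h1.le]
    intro φ hφ
    have hε : sideSign θ φ = 1 := if_pos <|
      Real.sin_nonneg_of_nonneg_of_le_pi (by linarith [hφ.1]) (by linarith [hφ.2])
    rw [upper φ ⟨by linarith [hφ.1], hφ.2.le⟩, hε]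
    ring
  have i1 : IntervalIntegrable F volume (-Real.pi) (θ - Real.pi) :=
    (intervalIntegrable_congr_uIoo e1).2
      ((continuous_const.add (hcont'.const_mul _)).intervalIntegrable _ _)
  have i2 : IntervalIntegrable F volume (θ - Real.pi) 0 :=
    (intervalIntegrable_congr_uIoo e2).2
      ((continuous_const.add (hcont'.const_mul _)).intervalIntegrable _ _)
  have i3 : IntervalIntegrable F volume 0 θ :=
    (intervalIntegrable_congr_uIoo e3).2 intervalIntegrable_const
  have i4 : IntervalIntegrable F volume θ Real.pi :=
    (intervalIntegrable_congr_uIoo e4).2 intervalIntegrable_const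
  rw [← intervalIntegral.integral_add_adjacent_intervals ((i1.trans i2).trans i3) i4,
    ← intervalIntegral.integral_add_adjacent_intervals (i1.trans i2) i3,
    ← intervalIntegral.integral_add_adjacent_intervals i1 i2,
    intervalIntegral.integral_congr_uIoo e1, intervalIntegral.integral_congr_uIoo e2,
    intervalIntegral.integral_congr_uIoo e3, intervalIntegral.integral_congr_uIoo e4,
    intervalIntegral.integral_add intervalIntegrable_const
      ((hcont'.const_mul _).intervalIntegrable _ _),
    intervalIntegral.integral_add intervalIntegrable_const
      ((hcont'.const_mul _).intervalIntegrable _ _),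
    intervalIntegral.integral_const_mul, intervalIntegral.integral_const_mul,
    intervalIntegral.integral_comp_add_right (fun t => Real.sin t ^ s),
    intervalIntegral.integral_comp_add_right (fun t => Real.sin t ^ s),
    ← intervalIntegral.integral_add_adjacent_intervals (hii 0 θ) (hii θ Real.pi)]
  simp only [intervalIntegral.integral_const, smul_eq_mul, neg_add_cancel, sub_add_cancel, zero_add]
  ring

/-- The angle equation satisfied by the nonlocal contact angle. -/
theorem YoungPV.angle_equation {s σ θ : ℝ} (hs : 0 < s) (hθ : θ ∈ Set.Ioo 0 Real.pi)
    (h : YoungPV 2 le_rfl s σ θ) :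
    σ * (∫ t in (0 : ℝ)..Real.pi, Real.sin t ^ s)
        + (∫ t in θ..Real.pi, Real.sin t ^ s) - (∫ t in (0 : ℝ)..θ, Real.sin t ^ s) = 0 := by
  have hsinθ : 0 < Real.sin θ := Real.sin_pos_of_pos_of_lt_pi hθ.1 hθ.2
  have hconst := h.congr' (f₂ := fun _ => (Real.sin θ ^ s)⁻¹ / s *
      (σ * (∫ t in (0 : ℝ)..Real.pi, Real.sin t ^ s)
        + (∫ t in θ..Real.pi, Real.sin t ^ s) - ∫ t in (0 : ℝ)..θ, Real.sin t ^ s)) <| by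
    filter_upwards [Ioo_mem_nhdsGT hsinθ] with ρ hρ
    rw [youngIntegral_eq_angular hs hθ hρ.1 hρ.2, angularIntegral_eq hs hθ]
  have hzero := tendsto_nhds_unique tendsto_const_nhds hconst
  exact (mul_eq_zero.1 hzero).resolve_left
    (div_pos (inv_pos.2 (Real.rpow_pos_of_pos hsinθ s)) hs).ne'

theorem tendsto_integral_sin_rpow :
    Tendsto (fun s : ℝ => ∫ t in (0 : ℝ)..Real.pi, (Real.sin t ^ s - Real.sin t))
      (𝓝[<] (1 : ℝ)) (𝓝 0) := by
  have hev : ∀ᶠ s : ℝ in 𝓝[<] (1 : ℝ), s ∈ Set.Ioo (0 : ℝ) 1 := Ioo_mem_nhdsLT one_pos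
  have := intervalIntegral.tendsto_integral_filter_of_dominated_convergence
    (μ := volume) (a := 0) (b := Real.pi) (l := 𝓝[<] (1 : ℝ))
    (F := fun s t => Real.sin t ^ s - Real.sin t) (f := fun _ => 0) (fun _ => (1 : ℝ))
    (hev.mono fun s hs =>
      ((continuous_sin_rpow hs.1).sub Real.continuous_sin).aestronglyMeasurable)
    (hev.mono fun s hs => ae_of_all _ fun t ht => ?_) intervalIntegrable_const
    (ae_of_all _ fun t ht => ?_)
  · simpa using this
  · rw [Set.uIoc_of_le Real.pi_pos.le] at ht
    have h0 := Real.sin_nonneg_of_nonneg_of_le_pi ht.1.le ht.2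
    have h1 := Real.rpow_le_one h0 (Real.sin_le_one t) hs.1.le
    have h2 := Real.rpow_nonneg h0 s
    rw [Real.norm_eq_abs, abs_le]
    constructor <;> linarith [Real.sin_le_one t]
  · have h : Tendsto (fun s : ℝ => Real.sin t ^ s) (𝓝[<] (1 : ℝ)) (𝓝 (Real.sin t ^ (1 : ℝ))) :=
      (Real.continuousAt_const_rpow' one_ne_zero).tendsto.mono_left nhdsWithin_le_nhds
    simpa using h.sub_const (Real.sin t)

/-- Quantitative closeness of the nonlocal contact angle to the classical one. -/
theorem abs_add_cos_le {s σ θ : ℝ} (hs : s ∈ Set.Ioo (0 : ℝ) 1) (hσ : |σ| ≤ 1)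
    (hθ : θ ∈ Set.Ioo 0 Real.pi) (h : YoungPV 2 le_rfl s σ θ) :
    |σ + Real.cos θ| ≤ ∫ t in (0 : ℝ)..Real.pi, (Real.sin t ^ s - Real.sin t) := by
  have heq := h.angle_equation hs.1 hθ
  have hii : ∀ a b, IntervalIntegrable (fun t : ℝ => Real.sin t ^ s) volume a b :=
    fun a b => (continuous_sin_rpow hs.1).intervalIntegrable a b
  have hsi : ∀ a b, IntervalIntegrable Real.sin volume a b :=
    fun a b => Real.continuous_sin.intervalIntegrable a b
  have hnn : ∀ t ∈ Set.Icc 0 Real.pi, 0 ≤ Real.sin t ^ s - Real.sin t := by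
    intro t ht
    have h0 := Real.sin_nonneg_of_nonneg_of_le_pi ht.1 ht.2
    have := Real.rpow_le_rpow_of_exponent_ge' h0 (Real.sin_le_one t) hs.1.le hs.2.le
    rw [Real.rpow_one] at this
    linarith
  have hp : 0 ≤ ∫ t in (0 : ℝ)..θ, (Real.sin t ^ s - Real.sin t) :=
    intervalIntegral.integral_nonneg hθ.1.le fun t ht => hnn t ⟨ht.1, ht.2.trans hθ.2.le⟩
  have hq : 0 ≤ ∫ t in θ..Real.pi, (Real.sin t ^ s - Real.sin t) :=
    intervalIntegral.integral_nonneg hθ.2.le fun t ht => hnn t ⟨hθ.1.le.trans ht.1, ht.2⟩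
  have hsplit := intervalIntegral.integral_add_adjacent_intervals (hii 0 θ) (hii θ Real.pi)
  rw [intervalIntegral.integral_sub (hii _ _) (hsi _ _), integral_sin] at hp hq ⊢
  rw [← hsplit] at heq ⊢
  rw [Real.cos_zero] at hp ⊢
  rw [Real.cos_pi] at hq ⊢
  obtain ⟨h1, h2⟩ := abs_le.1 hσ
  rw [abs_le]
  constructor <;> nlinarith

/-- The fractional contact angle converges to the classical Young's law
angle: `cos(π − θ(s,σ)) → σ` as `s → 1⁻`. -/
theorem stmt7 (σ : ℝ) (hσ : σ ∈ Set.Ioo (-1 : ℝ) 1) (θf : ℝ → ℝ)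
    (hθf : ∀ s ∈ Set.Ioo (0 : ℝ) 1,
      θf s ∈ Set.Ioo 0 Real.pi ∧ YoungPV 2 (by omega) s σ (θf s)) :
    Tendsto (fun s : ℝ => Real.cos (Real.pi - θf s)) (𝓝[<] (1 : ℝ)) (nhds σ) := by
  have hσ' : |σ| ≤ 1 := abs_le.2 ⟨hσ.1.le, hσ.2.le⟩
  rw [tendsto_iff_norm_sub_tendsto_zero]
  refine squeeze_zero' (.of_forall fun _ => norm_nonneg _) ?_ tendsto_integral_sin_rpow
  filter_upwards [Ioo_mem_nhdsLT one_pos] with s hs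
  rw [Real.cos_pi_sub, Real.norm_eq_abs, ← abs_neg,
    show -(-Real.cos (θf s) - σ) = σ + Real.cos (θf s) by ring]
  exact abs_add_cos_le hs hσ' (hθf s hs).1 (hθf s hs).2
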